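/- If G is a minimal counterexample, then every vertex of G has degree at least 2. -/

import Mathlib

open SimpleGraph

/-- A `(1,2^k)`-packing edge-coloring encoded as a function assigning a color in
`Fin (k+1)` to each unordered pair. Color `0` is the 1-color (its class must be a
matching) and each color `i ≠ 0` is a 2-color (its class must be an induced matching). -/
def IsPackingEC {V : Type} (G : SimpleGraph V) (k : ℕ)
    (c : Sym2 V → Fin (k + 1)) : Prop :=
  (∀ a b x y : V, G.Adj a b → G.Adj x y → s(a, b) ≠ s(x, y) →
      c s(a, b) = 0 → c s(x, y) = 0 →
      a ≠ x ∧ a ≠ y ∧ b ≠ x ∧ b ≠ y) ∧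
  ∀ a b x y : V, G.Adj a b → G.Adj x y → s(a, b) ≠ s(x, y) →
      c s(a, b) = c s(x, y) → c s(a, b) ≠ 0 →
      (a ≠ x ∧ a ≠ y ∧ b ≠ x ∧ b ≠ y) ∧
      ¬G.Adj a x ∧ ¬G.Adj a y ∧ ¬G.Adj b x ∧ ¬G.Adj b y

/-- A good coloring: a `(1,2^7)`-packing edge-coloring in which every edge of the
1-color class (color `0`) has both endpoints of degree 3. -/
def GoodColoring {V : Type} (G : SimpleGraph V) (c : Sym2 V → Fin 8) : Prop :=
  IsPackingEC G 7 c ∧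
  ∀ a b : V, G.Adj a b → c s(a, b) = 0 →
    (G.neighborSet a).ncard = 3 ∧ (G.neighborSet b).ncard = 3

/-- A graph is subcubic if every vertex has degree at most 3. -/
def Subcubic {V : Type} (G : SimpleGraph V) : Prop :=
  ∀ v : V, (G.neighborSet v).ncard ≤ 3

/-- A minimal counterexample: a finite subcubic simple graph with no good coloring such
that every finite subcubic simple graph with smaller `|V| + |E|` has a good coloring. -/
def MinCounter (V : Type) [Finite V] (G : SimpleGraph V) : Prop :=
  Subcubic G ∧
  (¬∃ c : Sym2 V → Fin 8, GoodColoring G c) ∧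
  ∀ (W : Type) [Finite W] (H : SimpleGraph W), Subcubic H →
    Nat.card W + H.edgeSet.ncard < Nat.card V + G.edgeSet.ncard →
    ∃ c : Sym2 W → Fin 8, GoodColoring H c

/-- A good coloring of `G - v` extends to `G` when the vertex `v` is isolated in `G`. -/
lemma exists_goodColoring_of_isolated {V : Type} {G : SimpleGraph V} {v : V}
    (hv : ∀ x, ¬G.Adj v x) {c : Sym2 {x : V // x ≠ v} → Fin 8}
    (hc : GoodColoring (G.comap (Subtype.val : {x : V // x ≠ v} → V)) c) :
    ∃ c' : Sym2 V → Fin 8, GoodColoring G c' := by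
  have ne {a b : V} (h : G.Adj a b) : a ≠ v ∧ b ≠ v :=
    ⟨by rintro rfl; exact hv _ h, by rintro rfl; exact hv _ h.symm⟩
  have hcol (a b : {x : V // x ≠ v}) :
      Function.extend (Sym2.map Subtype.val) c 0 s(a.1, b.1) = c s(a, b) :=
    (Sym2.map.injective Subtype.val_injective).extend_apply c 0 s(a, b)
  have hdeg (a : {x : V // x ≠ v}) : (G.neighborSet a.1).ncard =
      ((G.comap (Subtype.val : {x : V // x ≠ v} → V)).neighborSet a).ncard := by
    rw [← Set.ncard_image_of_injective _ Subtype.val_injective]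
    congr 1
    ext x
    simp only [mem_neighborSet, Set.mem_image, comap_adj, Subtype.exists]
    exact ⟨fun h => ⟨x, (ne h).2, h, rfl⟩, by rintro ⟨y, _, h, rfl⟩; exact h⟩
  obtain ⟨⟨h0, h1⟩, h3⟩ := hc
  refine ⟨Function.extend (Sym2.map Subtype.val) c 0, ⟨?_, ?_⟩, ?_⟩
  · intro a b x y hab hxy hne ha hx
    lift a to {x : V // x ≠ v} using (ne hab).1
    lift b to {x : V // x ≠ v} using (ne hab).2
    lift x to {x : V // x ≠ v} using (ne hxy).1
    lift y to {x : V // x ≠ v} using (ne hxy).2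
    rw [hcol] at ha hx
    simpa [Subtype.ext_iff] using
      h0 a b x y hab hxy (fun h => hne (congrArg (Sym2.map Subtype.val) h)) ha hx
  · intro a b x y hab hxy hne he ha
    lift a to {x : V // x ≠ v} using (ne hab).1
    lift b to {x : V // x ≠ v} using (ne hab).2
    lift x to {x : V // x ≠ v} using (ne hxy).1
    lift y to {x : V // x ≠ v} using (ne hxy).2
    rw [hcol] at he ha
    rw [hcol] at he
    simpa [Subtype.ext_iff] using
      h1 a b x y hab hxy (fun h => hne (congrArg (Sym2.map Subtype.val) h)) he ha
  · intro a b hab ha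
    lift a to {x : V // x ≠ v} using (ne hab).1
    lift b to {x : V // x ≠ v} using (ne hab).2
    rw [hcol] at ha
    rw [hdeg, hdeg]
    exact h3 a b hab ha

/-- If a vertex `u` of a subcubic graph has degree at most two, then some nonzero color out of
eight is absent from all edges meeting the neighbors of `u`. -/
lemma exists_free_color {V : Type} [Finite V] {H : SimpleGraph V} (hH : Subcubic H) {u : V}
    (hu : (H.neighborSet u).ncard ≤ 2) (c : Sym2 V → Fin 8) :
    ∃ k : Fin 8, k ≠ 0 ∧ ∀ w x, H.Adj u w → H.Adj w x → c s(w, x) ≠ k := by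
  classical
  have := Fintype.ofFinite V
  let N (w : V) : Finset V := (H.neighborSet w).toFinset
  have hN (w : V) : (N w).card = (H.neighborSet w).ncard :=
    (Set.ncard_eq_toFinset_card' _).symm
  let S : Finset (Fin 8) := insert 0 ((N u).biUnion fun w => (N w).image fun x => c s(w, x))
  have hS : S.card < (Finset.univ : Finset (Fin 8)).card := by
    have h1 : ((N u).biUnion fun w => (N w).image fun x => c s(w, x)).card ≤ (N u).card * 3 :=
      Finset.card_biUnion_le_card_mul _ _ _ fun w _ =>
        Finset.card_image_le.trans ((hN w).trans_le (hH w))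
    have h2 : S.card ≤ _ + 1 := Finset.card_insert_le _ _
    rw [hN] at h1
    rw [Finset.card_univ, Fintype.card_fin]
    omega
  obtain ⟨k, -, hk⟩ := Finset.exists_mem_notMem_of_card_lt_card hS
  refine ⟨k, fun h => hk (by simp [S, h]), fun w x huw hwx h => hk ?_⟩
  simp only [S, N, Finset.mem_insert, Finset.mem_biUnion, Finset.mem_image, Set.mem_toFinset,
    mem_neighborSet]
  exact Or.inr ⟨w, huw, x, hwx, h⟩

/-- A good coloring of a subcubic graph with a pendant edge removed extends to that edge. -/
lemma exists_goodColoring_of_pendant {V : Type} [Finite V] {G : SimpleGraph V}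
    (hG : Subcubic G) {u v : V} (hv : ∀ x, G.Adj v x ↔ x = u) {c : Sym2 V → Fin 8}
    (hc : GoodColoring (G.deleteEdges {s(u, v)}) c) :
    ∃ c' : Sym2 V → Fin 8, GoodColoring G c' := by
  classical
  set H := G.deleteEdges {s(u, v)} with hHdef
  have hle : H ≤ G := deleteEdges_le _
  have hadj (a b : V) : H.Adj a b ↔ G.Adj a b ∧ s(a, b) ≠ s(u, v) := by
    simp [hHdef, deleteEdges_adj]
  have hnb (a : V) : (H.neighborSet a).ncard ≤ (G.neighborSet a).ncard :=
    Set.ncard_le_ncard (fun x hx => hle hx) (Set.toFinite _)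
  have huv : G.Adj u v := ((hv u).2 rfl).symm
  have hHu : (H.neighborSet u).ncard ≤ 2 := by
    have : (H.neighborSet u).ncard < (G.neighborSet u).ncard := by
      refine Set.ncard_lt_ncard ⟨fun x hx => hle hx, fun h => ?_⟩ (Set.toFinite _)
      exact ((hadj u v).1 (h huv)).2 rfl
    have := hG u
    omega
  obtain ⟨k, hk0, hk⟩ := exists_free_color (fun a => (hnb a).trans (hG a)) hHu c
  have hHv (x : V) : ¬H.Adj v x := fun h => by
    obtain ⟨h1, h2⟩ := (hadj v x).1 h
    exact h2 (by rw [(hv x).1 h1, Sym2.eq_swap])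
  have far (x y : V) (hxy : H.Adj x y) (hcol : c s(x, y) = k) :
      x ≠ u ∧ x ≠ v ∧ ¬G.Adj u x ∧ ¬G.Adj v x := by
    have hxu : x ≠ u := by
      rintro rfl
      exact hk y x hxy hxy.symm (by rwa [Sym2.eq_swap])
    have hxv : x ≠ v := by
      rintro rfl
      exact hHv _ hxy
    refine ⟨hxu, hxv, fun h => hk x y ((hadj u x).2 ⟨h, ?_⟩) hxy hcol,
      fun h => hxu ((hv x).1 h)⟩
    simpa using ⟨hxv, fun _ => hxu⟩
  have far' (a b x y : V) (hab : s(a, b) = s(u, v)) (hxy : H.Adj x y) (hcol : c s(x, y) = k) :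
      (a ≠ x ∧ a ≠ y ∧ b ≠ x ∧ b ≠ y) ∧
        ¬G.Adj a x ∧ ¬G.Adj a y ∧ ¬G.Adj b x ∧ ¬G.Adj b y := by
    have hx := far x y hxy hcol
    have hy := far y x hxy.symm (by rwa [Sym2.eq_swap])
    rcases Sym2.eq_iff.1 hab with ⟨rfl, rfl⟩ | ⟨rfl, rfl⟩ <;> grind
  have hnew : Function.update c s(u, v) k s(u, v) = k := Function.update_self _ _ _
  have hold (a b : V) (h : s(a, b) ≠ s(u, v)) :
      Function.update c s(u, v) k s(a, b) = c s(a, b) := Function.update_of_ne h _ _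
  obtain ⟨⟨h0, h1⟩, h3⟩ := hc
  refine ⟨Function.update c s(u, v) k, ⟨?_, ?_⟩, ?_⟩
  · intro a b x y hab hxy hne ha hx
    have hab' : s(a, b) ≠ s(u, v) := fun h => hk0 (by rw [← ha, h, hnew])
    have hxy' : s(x, y) ≠ s(u, v) := fun h => hk0 (by rw [← hx, h, hnew])
    rw [hold _ _ hab'] at ha
    rw [hold _ _ hxy'] at hx
    exact h0 a b x y ((hadj _ _).2 ⟨hab, hab'⟩) ((hadj _ _).2 ⟨hxy, hxy'⟩) hne ha hx
  · intro a b x y hab hxy hne he ha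
    by_cases hab' : s(a, b) = s(u, v)
    · have hxy' : s(x, y) ≠ s(u, v) := fun h => hne (hab'.trans h.symm)
      rw [hab', hnew, hold _ _ hxy'] at he
      exact far' a b x y hab' ((hadj _ _).2 ⟨hxy, hxy'⟩) he.symm
    by_cases hxy' : s(x, y) = s(u, v)
    · rw [hxy', hnew, hold _ _ hab'] at he
      have := far' x y a b hxy' ((hadj _ _).2 ⟨hab, hab'⟩) he
      simp only [G.adj_comm a, G.adj_comm b]
      grind
    rw [hold _ _ hab', hold _ _ hxy'] at he
    rw [hold _ _ hab'] at ha
    have hH := h1 a b x y ((hadj _ _).2 ⟨hab, hab'⟩) ((hadj _ _).2 ⟨hxy, hxy'⟩) hne he ha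
    have ne_v {p q : V} (h : G.Adj p q) (h' : s(p, q) ≠ s(u, v)) : p ≠ v ∧ q ≠ v := by
      have hpq := (hadj p q).2 ⟨h, h'⟩
      exact ⟨by rintro rfl; exact hHv _ hpq, by rintro rfl; exact hHv _ hpq.symm⟩
    have lift_adj {p q : V} (hp : p ≠ v) (hq : q ≠ v) (h : ¬H.Adj p q) : ¬G.Adj p q :=
      fun h' => h ((hadj p q).2 ⟨h', by
        intro he
        rcases Sym2.eq_iff.1 he with ⟨_, h⟩ | ⟨h, _⟩
        exacts [hq h, hp h]⟩)
    obtain ⟨ha, hb⟩ := ne_v hab hab'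
    obtain ⟨hx, hy⟩ := ne_v hxy hxy'
    exact ⟨hH.1, lift_adj ha hx hH.2.1, lift_adj ha hy hH.2.2.1, lift_adj hb hx hH.2.2.2.1,
      lift_adj hb hy hH.2.2.2.2⟩
  · intro a b hab ha
    have hab' : s(a, b) ≠ s(u, v) := fun h => hk0 (by rw [← ha, h, hnew])
    rw [hold _ _ hab'] at ha
    obtain ⟨h4, h5⟩ := h3 a b ((hadj _ _).2 ⟨hab, hab'⟩) ha
    exact ⟨(hG a).antisymm (h4 ▸ hnb a), (hG b).antisymm (h5 ▸ hnb b)⟩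

/-- In a minimal counterexample every vertex has degree at least 2. -/
theorem minCounter_min_degree_two {V : Type} [Finite V] (G : SimpleGraph V)
    (hG : MinCounter V G) :
    ∀ v : V, 2 ≤ (G.neighborSet v).ncard := by
  obtain ⟨hsub, hno, hmin⟩ := hG
  intro v
  by_contra! hlt
  obtain h | h : (G.neighborSet v).ncard = 0 ∨ (G.neighborSet v).ncard = 1 := by omega
  · have hv (x : V) : ¬G.Adj v x := fun hx => by
      rw [Set.ncard_eq_zero (Set.toFinite _)] at h
      exact (h ▸ hx : x ∈ (∅ : Set V))
    obtain ⟨c, hc⟩ := hmin {x : V // x ≠ v} (G.comap Subtype.val)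
      (fun a => by
        refine le_trans ?_ (hsub a.1)
        rw [← Set.ncard_image_of_injective _ Subtype.val_injective]
        refine Set.ncard_le_ncard ?_ (Set.toFinite _)
        rintro _ ⟨x, hx, rfl⟩
        exact hx)
      (by
        refine add_lt_add_of_lt_of_le (Finite.card_subtype_lt (x := v) (by simp)) ?_
        rw [← Set.ncard_image_of_injective _ (Sym2.map.injective Subtype.val_injective)]
        refine Set.ncard_le_ncard ?_ (Set.toFinite _)
        rintro _ ⟨e, he, rfl⟩
        induction e with | _ a b => exact he)
    exact hno (exists_goodColoring_of_isolated hv hc)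
  · obtain ⟨u, hu⟩ := Set.ncard_eq_one.1 h
    have hv (x : V) : G.Adj v x ↔ x = u := by
      rw [← mem_neighborSet, hu, Set.mem_singleton_iff]
    obtain ⟨c, hc⟩ := hmin V (G.deleteEdges {s(u, v)})
      (fun a => (Set.ncard_le_ncard (fun x hx => deleteEdges_le _ hx) (Set.toFinite _)).trans
        (hsub a))
      (by
        refine Nat.add_lt_add_left (Set.ncard_lt_ncard ?_ (Set.toFinite _)) _
        rw [edgeSet_deleteEdges]
        exact Set.sdiff_ssubset_left_iff.2 ⟨s(u, v), ((hv u).2 rfl).symm, rfl⟩)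
    exact hno (exists_goodColoring_of_pendant hsub hv hc)
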